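/- Fix n ≥ 3 and ε > 0. There is no mechanism f : (ℝ²)ⁿ × ℝ² → ℝ² (mapping a profile of reported points and a prediction to a facility location) that is simultaneously strategyproof, anonymous, (2 − ε)-consistent, and (1 + √2 − ε)-robust with respect to the egalitarian objective. -/

import Mathlib

/-- Euclidean distance on the plane. -/
noncomputable def eudist (a b : ℝ × ℝ) : ℝ :=
  Real.sqrt ((a.1 - b.1) ^ 2 + (a.2 - b.2) ^ 2)

/-- Egalitarian social cost: the maximum distance from `y` to the points of `P`. -/
noncomputable def Ce {n : ℕ} (y : ℝ × ℝ) (P : Fin n → ℝ × ℝ) : ℝ :=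
  ⨆ i, eudist y (P i)

/-- The Minimum Bounding Box mechanism: the prediction clamped coordinatewise to
the minimum axis-parallel bounding box of the reported points. -/
noncomputable def MBB {n : ℕ} (P : Fin n → ℝ × ℝ) (oh : ℝ × ℝ) : ℝ × ℝ :=
  (max (⨅ i, (P i).1) (min (⨆ i, (P i).1) oh.1),
   max (⨅ i, (P i).2) (min (⨆ i, (P i).2) oh.2))

/-- A two-agent mechanism on `E` that is strategyproof and unanimous and, with prediction `0`,
does not select either of the two locations of an antipodal pair. -/
structure IsTwoAgentMechanism {E : Type*} [NormedAddCommGroup E] (F : E → E → E) : Prop where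
  left_le : ∀ a a' b, ‖a - F a b‖ ≤ ‖a - F a' b‖
  right_le : ∀ a b b', ‖b - F a b‖ ≤ ‖b - F a b'‖
  unanimous : ∀ x, F x x = x
  left_ne : ∀ y, y ≠ 0 → F y (-y) ≠ y
  right_ne : ∀ y, y ≠ 0 → F (-y) y ≠ y

namespace IsTwoAgentMechanism

variable {E : Type*} [NormedAddCommGroup E] {F : E → E → E}

theorem flip (hF : IsTwoAgentMechanism F) : IsTwoAgentMechanism fun a b => F b a where
  left_le a a' b := hF.right_le b a a'
  right_le a b b' := hF.left_le b b' a
  unanimous := hF.unanimous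
  left_ne := hF.right_ne
  right_ne := hF.left_ne

theorem left_fixed (hF : IsTwoAgentMechanism F) {a b x : E} (h : F a b = x) : F x b = x := by
  have := hF.left_le x a b
  rw [h, sub_self, norm_zero, norm_le_zero_iff, sub_eq_zero] at this
  exact this.symm

theorem right_fixed (hF : IsTwoAgentMechanism F) {a b x : E} (h : F a b = x) : F a x = x :=
  hF.flip.left_fixed h

end IsTwoAgentMechanism

section InnerProduct

variable {E : Type*} [NormedAddCommGroup E] [InnerProductSpace ℝ E]

theorem norm_sub_add_smul_sq (a x d : E) (t : ℝ) :
    ‖a - (x + t • d)‖ ^ 2 = ‖a - x‖ ^ 2 - 2 * t * inner ℝ (a - x) d + t ^ 2 * ‖d‖ ^ 2 := by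
  rw [← sub_sub, norm_sub_sq_real, inner_smul_right, norm_smul, mul_pow, Real.norm_eq_abs, sq_abs]
  ring

theorem inner_sub_nonpos_of_forall_norm_sub_le {a x y : E}
    (h : ∀ t : ℝ, 0 < t → t < 1 → ‖a - x‖ ≤ ‖a - (x + t • (y - x))‖) :
    inner ℝ (a - x) (y - x) ≤ 0 := by
  by_contra! hp
  set p := inner ℝ (a - x) (y - x) with hpdef
  set q := ‖y - x‖ ^ 2 with hq
  have hq0 : 0 ≤ q := by positivity
  have hd : 0 < p + q + 1 := by linarith
  have ht0 : 0 < p / (p + q + 1) := by positivity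
  have ht1 : p / (p + q + 1) < 1 := by rw [div_lt_one hd]; linarith
  have h1 := pow_le_pow_left₀ (norm_nonneg _) (h _ ht0 ht1) 2
  rw [norm_sub_add_smul_sq, ← hpdef, ← hq] at h1
  have h2 : p / (p + q + 1) * (p + q + 1) = p := by field_simp
  set t := p / (p + q + 1)
  have h3 : t * (2 * p) ≤ t * (t * q) := by nlinarith
  have h4 := le_of_mul_le_mul_left h3 ht0
  nlinarith

theorem nearest_selection_star {φ : E → E} (hφ : ∀ p q, ‖p - φ p‖ ≤ ‖p - φ q‖) {c : E}
    (hc : ∀ p, inner ℝ (p - φ p) (c - φ p) ≤ 0) {y : E} (hy : φ y = y) {t : ℝ}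
    (ht0 : 0 ≤ t) (ht1 : t ≤ 1) : φ (y + t • (c - y)) = y + t • (c - y) := by
  have step : ∀ τ Δ : ℝ, τ < 1 → 0 ≤ Δ →
      ‖y + (τ + Δ) • (c - y) - φ (y + (τ + Δ) • (c - y))‖ ^ 2 ≤
        ‖y + τ • (c - y) - φ (y + τ • (c - y))‖ ^ 2 + Δ ^ 2 * ‖c - y‖ ^ 2 := by
    intro τ Δ hτ hΔ
    have h1 := pow_le_pow_left₀ (norm_nonneg _)
      (hφ (y + (τ + Δ) • (c - y)) (y + τ • (c - y))) 2
    have h2 := hc (y + τ • (c - y))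
    set e := y + τ • (c - y) - φ (y + τ • (c - y)) with he
    have e1 : y + (τ + Δ) • (c - y) - φ (y + τ • (c - y)) = e + Δ • (c - y) := by
      rw [he]; module
    have e2 : c - φ (y + τ • (c - y)) = e + (1 - τ) • (c - y) := by
      rw [he]; module
    rw [e1, norm_add_sq_real, inner_smul_right, norm_smul, mul_pow, Real.norm_eq_abs, sq_abs] at h1
    rw [e2, inner_add_right, inner_smul_right, real_inner_self_eq_norm_sq] at h2
    have h3 : inner ℝ e (c - y) ≤ 0 := by
      by_contra! h
      nlinarith [sq_nonneg ‖e‖, mul_pos (sub_pos.2 hτ) h]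
    nlinarith [mul_nonneg hΔ (neg_nonneg.2 h3)]
  have bound : ∀ N : ℕ, 0 < N → ∀ k : ℕ, k ≤ N →
      ‖y + ((k : ℝ) * (t / N)) • (c - y) - φ (y + ((k : ℝ) * (t / N)) • (c - y))‖ ^ 2 ≤
        k * ((t / N) ^ 2 * ‖c - y‖ ^ 2) := by
    intro N hN k
    induction k with
    | zero => intro _; simp [hy]
    | succ k ih =>
      intro hk
      have hN' : (0 : ℝ) < N := by exact_mod_cast hN
      have hk' : (k : ℝ) < N := by exact_mod_cast hk
      have hlt : (k : ℝ) * (t / N) < 1 := by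
        rw [← mul_div_assoc, div_lt_one hN']
        nlinarith [Nat.cast_nonneg (α := ℝ) k]
      have h1 := step _ (t / N) hlt (by positivity)
      have h2 := ih (by omega)
      have e : ((k + 1 : ℕ) : ℝ) * (t / N) = k * (t / N) + t / N := by push_cast; ring
      rw [e]
      push_cast
      linarith
  set g := ‖y + t • (c - y) - φ (y + t • (c - y))‖ ^ 2 with hg
  have hle : ∀ N : ℕ, 0 < N → g * N ≤ t ^ 2 * ‖c - y‖ ^ 2 := by
    intro N hN
    have hN' : (N : ℝ) ≠ 0 := by positivity
    have h := bound N hN N le_rfl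
    rw [mul_div_cancel₀ t hN', ← hg] at h
    have e : (N : ℝ) * ((t / N) ^ 2 * ‖c - y‖ ^ 2) * N = t ^ 2 * ‖c - y‖ ^ 2 := by
      field_simp
    calc g * N ≤ (N : ℝ) * ((t / N) ^ 2 * ‖c - y‖ ^ 2) * N := by gcongr
      _ = _ := e
  have hg0 : g ≤ 0 := by
    by_contra! hpos
    obtain ⟨N, hN⟩ := exists_nat_gt (t ^ 2 * ‖c - y‖ ^ 2 / g)
    rw [div_lt_iff₀ hpos] at hN
    have := hle (N + 1) (by omega)
    push_cast at this
    nlinarith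
  have : ‖y + t • (c - y) - φ (y + t • (c - y))‖ = 0 :=
    pow_eq_zero_iff two_ne_zero |>.1 (le_antisymm hg0 (by positivity))
  exact (sub_eq_zero.1 (norm_eq_zero.1 this)).symm

theorem eq_zero_of_inner_sub_nonneg {b y : E} (h1 : inner ℝ b y ≤ 0)
    (h2 : 0 ≤ inner ℝ (b - y) y) : y = 0 := by
  rw [inner_sub_left, real_inner_self_eq_norm_sq] at h2
  have : ‖y‖ ^ 2 = 0 := le_antisymm (by linarith) (by positivity)
  simpa using this

namespace IsTwoAgentMechanism

variable {F : E → E → E}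

theorem eq_of_between (hF : IsTwoAgentMechanism F) {a b x : E} (h : F a b = x) {t : ℝ}
    (ht0 : 0 ≤ t) (ht1 : t < 1) : F a (x + t • (b - x)) = x := by
  have h1 := pow_le_pow_left₀ (norm_nonneg _) (hF.right_le a (x + t • (b - x)) b) 2
  have h2 := pow_le_pow_left₀ (norm_nonneg _) (hF.right_le a b (x + t • (b - x))) 2
  rw [h] at h1 h2
  set x' := F a (x + t • (b - x))
  have e1 : x + t • (b - x) - x' = t • (b - x) - (x' - x) := by abel
  have e2 : x + t • (b - x) - x = t • (b - x) := by abel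
  have e3 : b - x' = (b - x) - (x' - x) := by abel
  rw [e1, e2, norm_sub_sq_real, inner_smul_left] at h1
  rw [e3, norm_sub_sq_real (b - x) (x' - x)] at h2
  simp only [conj_trivial] at h1
  have h3 : ‖x' - x‖ ^ 2 ≤ 0 := by
    by_contra! hpos
    nlinarith [mul_pos (sub_pos.2 ht1) hpos]
  have : ‖x' - x‖ ^ 2 = 0 := le_antisymm h3 (by positivity)
  exact sub_eq_zero.1 (norm_eq_zero.1 ((pow_eq_zero_iff two_ne_zero).1 this))

theorem inner_agents_nonpos (hF : IsTwoAgentMechanism F) (a b : E) :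
    inner ℝ (a - F a b) (b - F a b) ≤ 0 := by
  refine inner_sub_nonpos_of_forall_norm_sub_le fun t ht0 ht1 => ?_
  have h := hF.eq_of_between (a := a) (b := b) rfl ht0.le ht1
  have h2 := hF.left_le a (F a b + t • (b - F a b)) (F a b + t • (b - F a b))
  rwa [h, hF.unanimous] at h2

theorem inner_left_option_nonpos (hF : IsTwoAgentMechanism F) {a x y : E} (h : F a x = x)
    (hy : F y x = y) : inner ℝ (a - x) (y - x) ≤ 0 := by
  refine inner_sub_nonpos_of_forall_norm_sub_le fun t ht0 ht1 => ?_
  have h1 := nearest_selection_star (φ := fun p => F p x) (fun p q => hF.left_le p q x)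
    (fun p => hF.inner_agents_nonpos p x) hy (t := 1 - t) (by linarith) (by linarith)
  have e : y + (1 - t) • (x - y) = x + t • (y - x) := by module
  rw [e] at h1
  have h2 := hF.left_le a (x + t • (y - x)) x
  rwa [h, h1] at h2

theorem left_eq_of_ray (hF : IsTwoAgentMechanism F) {a x : E} (h : F a x = x) {t : ℝ}
    (ht : 0 ≤ t) : F (x + t • (a - x)) x = x := by
  obtain ⟨y, hy⟩ : ∃ y, F (x + t • (a - x)) x = y := ⟨_, rfl⟩
  have h1 := hF.inner_left_option_nonpos h (hF.left_fixed hy)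
  have h2 := hF.inner_agents_nonpos (x + t • (a - x)) x
  rw [hy] at h2 ⊢
  have e : x + t • (a - x) - y = t • (a - x) - (y - x) := by abel
  rw [e, ← neg_sub y x, inner_neg_right, inner_sub_left, inner_smul_left,
    real_inner_self_eq_norm_sq] at h2
  simp only [conj_trivial] at h2
  have : ‖y - x‖ ^ 2 = 0 := le_antisymm (by nlinarith) (by positivity)
  exact sub_eq_zero.1 (norm_eq_zero.1 ((pow_eq_zero_iff two_ne_zero).1 this))

theorem zero_left (hF : IsTwoAgentMechanism F) (b : E) : F 0 b = 0 := by
  by_contra hne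
  have h := hF.left_eq_of_ray (hF.right_fixed (a := 0) (b := b) rfl) (t := 2) (by norm_num)
  refine hF.right_ne _ hne ?_
  convert h using 2
  module

theorem inner_sub_nonneg_of_right_fixed (hF : IsTwoAgentMechanism F) {a y : E} (h : F a y = y) :
    0 ≤ inner ℝ (a - y) y := by
  have := hF.inner_left_option_nonpos h (hF.zero_left y)
  rw [zero_sub, inner_neg_right] at this
  linarith

theorem inner_sub_nonneg_of_left_fixed (hF : IsTwoAgentMechanism F) {b y : E} (h : F y b = y) :
    0 ≤ inner ℝ (b - y) y :=
  hF.flip.inner_sub_nonneg_of_right_fixed h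

theorem right_fixed_smul (hF : IsTwoAgentMechanism F) {a y : E} (h : F a y = y) {s : ℝ}
    (hs0 : 0 ≤ s) (hs1 : s ≤ 1) : F a (s • y) = s • y := by
  have h1 := nearest_selection_star (φ := fun p => F a p) (c := 0)
    (fun p q => hF.right_le a p q)
    (fun p => by
      have := hF.inner_sub_nonneg_of_left_fixed (hF.left_fixed (a := a) (b := p) rfl)
      rw [zero_sub, inner_neg_right]
      linarith) h (t := 1 - s) (by linarith) (by linarith)
  have e : y + (1 - s) • (0 - y) = s • y := by module
  rwa [e] at h1

theorem right_fixed_toward (hF : IsTwoAgentMechanism F) {a y : E} (h : F a y = y) {t : ℝ}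
    (ht0 : 0 ≤ t) (ht1 : t ≤ 1) : F a (y + t • (a - y)) = y + t • (a - y) :=
  nearest_selection_star (φ := fun p => F a p) (fun p q => hF.right_le a p q)
    (fun p => by rw [real_inner_comm]; exact hF.inner_agents_nonpos a p) h ht0 ht1

theorem inner_nonpos_of_eq_zero (hF : IsTwoAgentMechanism F) {a b y : E} (h : F a b = 0)
    (hy : F a y = y) : inner ℝ b y ≤ 0 := by
  have := inner_sub_nonpos_of_forall_norm_sub_le (a := b) (x := 0) (y := y) fun t ht0 ht1 => by
    have h2 := hF.right_le a b (t • y)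
    rw [h, hF.right_fixed_smul hy ht0.le ht1.le] at h2
    simpa using h2
  simpa using this

theorem eq_zero_of_forall_inner_nonpos (hF : IsTwoAgentMechanism F) {a b : E}
    (h : ∀ y, F a y = y → inner ℝ b y ≤ 0) : F a b = 0 :=
  eq_zero_of_inner_sub_nonneg (h _ (hF.right_fixed rfl))
    (hF.inner_sub_nonneg_of_left_fixed (hF.left_fixed rfl))

end IsTwoAgentMechanism

end InnerProduct

section Plane

theorem Complex.real_inner_eq (z w : ℂ) : inner ℝ z w = z.re * w.re + z.im * w.im := by
  rw [Complex.inner]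
  simp
  ring

theorem Complex.norm_sq_eq_re_im (z : ℂ) : ‖z‖ ^ 2 = z.re ^ 2 + z.im ^ 2 := by
  rw [Complex.sq_norm, Complex.normSq_apply]
  ring

theorem Complex.inner_eq_inner_mul_inner_add {w : ℂ} (hw : ‖w‖ = 1) (x z : ℂ) :
    inner ℝ x z = inner ℝ w x * inner ℝ w z +
      inner ℝ (Complex.I * w) x * inner ℝ (Complex.I * w) z := by
  have h := Complex.norm_sq_eq_re_im w
  rw [hw] at h
  simp only [Complex.real_inner_eq, Complex.mul_re, Complex.mul_im, Complex.I_re, Complex.I_im]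
  linear_combination (x.re * z.re + x.im * z.im) * h

namespace IsTwoAgentMechanism

variable {F : ℂ → ℂ → ℂ}

/-- The extreme direction `w`, counterclockwise from `1`, of the options `y = F 1 y`. -/
theorem exists_extreme_direction (hF : IsTwoAgentMechanism F) :
    ∃ w : ℂ, ‖w‖ = 1 ∧ 0 ≤ w.re ∧ 0 ≤ w.im ∧
    (∀ y, F 1 y = y → inner ℝ (Complex.I * w) y ≤ 0) ∧
    (∀ δ > 0, ∃ y, y ≠ 0 ∧ F 1 y = y ∧ ‖(‖y‖⁻¹ : ℝ) • y - w‖ < δ) := by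
  set D : Set ℂ := {u | ∃ y, y ≠ 0 ∧ F 1 y = y ∧ (‖y‖⁻¹ : ℝ) • y = u} with hD
  have hDs : D ⊆ Metric.sphere 0 1 ∩ {u | 0 ≤ u.re} := by
    rintro u ⟨y, hy0, hy, rfl⟩
    have hn : 0 < ‖y‖ := norm_pos_iff.2 hy0
    refine ⟨?_, ?_⟩
    · rw [mem_sphere_zero_iff_norm, norm_smul, norm_inv, norm_norm, inv_mul_cancel₀ hn.ne']
    · have h := hF.inner_sub_nonneg_of_right_fixed hy
      rw [inner_sub_left, real_inner_self_eq_norm_sq, Complex.real_inner_eq] at h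
      simp only [Complex.one_re, Complex.one_im] at h
      have : 0 ≤ y.re := by nlinarith [sq_nonneg ‖y‖]
      simp only [Set.mem_ofPred_eq, Complex.smul_re, smul_eq_mul]
      positivity
  have hcl : closure D ⊆ Metric.sphere 0 1 ∩ {u | 0 ≤ u.re} :=
    closure_minimal hDs (Metric.isClosed_sphere.inter
      (isClosed_le continuous_const Complex.continuous_re))
  have hcomp : IsCompact (closure D) :=
    (isCompact_sphere (0 : ℂ) 1).of_isClosed_subset isClosed_closure
      fun u hu => (hcl hu).1
  have h1D : (1 : ℂ) ∈ closure D :=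
    subset_closure ⟨1, one_ne_zero, hF.unanimous 1, by simp⟩
  obtain ⟨w, hw, hmax⟩ := hcomp.exists_isMaxOn ⟨1, h1D⟩ Complex.continuous_im.continuousOn
  have hw1 : ‖w‖ = 1 := mem_sphere_zero_iff_norm.1 (hcl hw).1
  have hwim : 0 ≤ w.im := by simpa using hmax h1D
  have hwre : 0 ≤ w.re := (hcl hw).2
  refine ⟨w, hw1, hwre, hwim, ?_, ?_⟩
  · intro y hy
    rcases eq_or_ne y 0 with rfl | hy0
    · simp
    have hn : 0 < ‖y‖ := norm_pos_iff.2 hy0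
    have hu : (‖y‖⁻¹ : ℝ) • y ∈ closure D := subset_closure ⟨y, hy0, hy, rfl⟩
    have hle : ((‖y‖⁻¹ : ℝ) • y).im ≤ w.im := hmax hu
    have hre : 0 ≤ ((‖y‖⁻¹ : ℝ) • y).re := (hcl hu).2
    have hu1 : ‖(‖y‖⁻¹ : ℝ) • y‖ = 1 := mem_sphere_zero_iff_norm.1 (hcl hu).1
    have e : y = ‖y‖ • ((‖y‖⁻¹ : ℝ) • y) := by
      rw [smul_smul, mul_inv_cancel₀ hn.ne', one_smul]
    rw [e, inner_smul_right]
    refine mul_nonpos_of_nonneg_of_nonpos hn.le ?_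
    set u := (‖y‖⁻¹ : ℝ) • y
    have s1 := Complex.norm_sq_eq_re_im u
    have s2 := Complex.norm_sq_eq_re_im w
    rw [hu1] at s1
    rw [hw1] at s2
    rw [Complex.real_inner_eq]
    simp only [Complex.mul_re, Complex.mul_im, Complex.I_re, Complex.I_im]
    rcases le_total u.im 0 with h0 | h0
    · nlinarith [mul_nonneg hwim hre, mul_nonneg hwre (neg_nonneg.2 h0)]
    · have hsq : w.re ≤ u.re := by
        apply le_of_sq_le_sq _ hre
        nlinarith
      nlinarith [mul_le_mul hsq hle h0 hre]
  · intro δ hδ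
    obtain ⟨u, ⟨y, hy0, hy, rfl⟩, hd⟩ := Metric.mem_closure_iff.1 hw δ hδ
    exact ⟨y, hy0, hy, by rwa [dist_comm, dist_eq_norm] at hd⟩

set_option maxHeartbeats 400000 in
theorem eq_zero_of_near_extreme (hF : IsTwoAgentMechanism F) {w : ℂ} (hw : ‖w‖ = 1)
    (hext : ∀ y, F 1 y = y → inner ℝ (Complex.I * w) y ≤ 0)
    (happ : ∀ δ > 0, ∃ y, y ≠ 0 ∧ F 1 y = y ∧ ‖(‖y‖⁻¹ : ℝ) • y - w‖ < δ)
    {y : ℂ} (hyb : inner ℝ (Complex.I * w) y < 0) (hyw : 0 < inner ℝ w y) :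
    F y (Complex.I * w) = 0 := by
  by_contra hne
  set b := Complex.I * w with hb
  obtain ⟨v, hv⟩ : ∃ v, F y b = v := ⟨_, rfl⟩
  rw [hv] at hne
  have hyv : F y v = v := hF.right_fixed hv
  have hvpos : 0 < ‖v‖ ^ 2 := by positivity
  have hβ : 0 < inner ℝ b v := by
    have := hF.inner_sub_nonneg_of_left_fixed (hF.left_fixed hv)
    rw [inner_sub_left, real_inner_self_eq_norm_sq] at this
    linarith
  have hyvpos : 0 < inner ℝ y v := by
    have := hF.inner_sub_nonneg_of_right_fixed hyv
    rw [inner_sub_left, real_inner_self_eq_norm_sq] at this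
    linarith
  have hl : 0 < inner ℝ w v := by
    rw [Complex.inner_eq_inner_mul_inner_add hw y v, ← hb] at hyvpos
    by_contra! h
    nlinarith [mul_pos hβ (neg_pos.2 hyb), mul_nonneg hyw.le (neg_nonneg.2 h)]
  have hvw : ‖v - (inner ℝ w v : ℝ) • w‖ = inner ℝ b v := by
    rw [← sq_eq_sq₀ (norm_nonneg _) hβ.le, norm_sub_sq_real, inner_smul_right,
      real_inner_comm w v, norm_smul, hw, mul_one, Real.norm_eq_abs, sq_abs,
      ← real_inner_self_eq_norm_sq, Complex.inner_eq_inner_mul_inner_add hw v v, ← hb]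
    ring
  set β := inner ℝ b v
  set l := inner ℝ w v
  set c := inner ℝ w y with hc
  obtain ⟨d, hd⟩ : ∃ d, d = -inner ℝ b y := ⟨_, rfl⟩
  have hd0 : 0 < d := by linarith
  obtain ⟨η, hη0, hη1, hη2⟩ : ∃ η > 0, c ^ 2 * ((β + η) ^ 2 - β ^ 2) < (d * β / 2) ^ 2 ∧
      η * ‖v‖ * (β + η) < d * β / 2 := by
    have h1 : Filter.Tendsto (fun η : ℝ => c ^ 2 * ((β + η) ^ 2 - β ^ 2))
        (nhdsWithin 0 (Set.Ioi 0)) (nhds (c ^ 2 * ((β + 0) ^ 2 - β ^ 2))) :=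
      tendsto_nhdsWithin_of_tendsto_nhds (Continuous.tendsto (by fun_prop) 0)
    have h2 : Filter.Tendsto (fun η : ℝ => η * ‖v‖ * (β + η)) (nhdsWithin 0 (Set.Ioi 0))
        (nhds (0 * ‖v‖ * (β + 0))) :=
      tendsto_nhdsWithin_of_tendsto_nhds (Continuous.tendsto (by fun_prop) 0)
    have h3 := h1.eventually_lt_const (u := (d * β / 2) ^ 2) (by
      rw [add_zero, sub_self, mul_zero]; positivity)
    have h4 := h2.eventually_lt_const (u := d * β / 2) (by
      rw [zero_mul, zero_mul]; positivity)
    obtain ⟨η, ⟨h5, h6⟩, h7⟩ := ((h3.and h4).and self_mem_nhdsWithin).exists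
    exact ⟨η, h7, h5, h6⟩
  obtain ⟨p, hp0, hp, hpw⟩ := happ (η / (l + 1)) (by positivity)
  have hpn : 0 < ‖p‖ := norm_pos_iff.2 hp0
  obtain ⟨s, hs0, hs1, hsη, hsp⟩ : ∃ s : ℝ, 0 < s ∧ s ≤ 1 ∧ s ≤ η ∧ s * l ≤ ‖p‖ := by
    refine ⟨min 1 (min η (‖p‖ / (l + 1))), by positivity, min_le_left _ _,
      (min_le_right _ _).trans (min_le_left _ _), ?_⟩
    have h1 : min 1 (min η (‖p‖ / (l + 1))) ≤ ‖p‖ / (l + 1) :=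
      (min_le_right _ _).trans (min_le_right _ _)
    calc _ ≤ ‖p‖ / (l + 1) * l := by gcongr
      _ ≤ ‖p‖ / (l + 1) * (l + 1) := by gcongr; linarith
      _ = ‖p‖ := by field_simp
  obtain ⟨z, hz⟩ : ∃ z, F 1 (s • v) = z := ⟨_, rfl⟩
  have hbz : inner ℝ b z ≤ 0 := hext z (hF.right_fixed hz)
  have hyz : inner ℝ (y - s • v) (z - s • v) ≤ 0 :=
    hF.inner_left_option_nonpos (hF.right_fixed_smul hyv hs0.le hs1) (hF.left_fixed hz)
  have hnear : ‖z - s • v‖ ≤ s * (β + η) := by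
    have h1 := hF.right_le 1 (s • v) ((s * l / ‖p‖) • p)
    rw [hF.right_fixed_smul hp (by positivity) ((div_le_one hpn).2 hsp), hz, norm_sub_rev] at h1
    refine h1.trans ?_
    have e : s • v - (s * l / ‖p‖) • p = s • ((v - l • w) - l • ((‖p‖⁻¹ : ℝ) • p - w)) := by
      module
    rw [e, norm_smul, Real.norm_of_nonneg hs0.le]
    gcongr
    refine (norm_sub_le _ _).trans ?_
    rw [hvw, norm_smul, Real.norm_of_nonneg hl.le]
    gcongr
    calc l * ‖(‖p‖⁻¹ : ℝ) • p - w‖ ≤ (l + 1) * (η / (l + 1)) := by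
          gcongr; linarith
      _ = η := by field_simp
  set e := z - s • v with he
  have hbe : inner ℝ b e ≤ -(s * β) := by
    rw [he, inner_sub_right, inner_smul_right]
    linarith
  have hve : inner ℝ v e ≤ ‖v‖ * (s * (β + η)) :=
    (real_inner_le_norm v e).trans (by gcongr)
  have hye : inner ℝ y e < s * (d * β / 2) := by
    rw [inner_sub_left, inner_smul_left] at hyz
    simp only [conj_trivial] at hyz
    calc inner ℝ y e ≤ s * inner ℝ v e := by linarith
      _ ≤ s * (‖v‖ * (η * (β + η))) := by
          gcongr
          exact hve.trans (by gcongr)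
      _ < s * (d * β / 2) := by
          gcongr
          linarith
  have hnorm : inner ℝ w e ^ 2 + inner ℝ b e ^ 2 ≤ (s * (β + η)) ^ 2 := by
    have h1 := pow_le_pow_left₀ (norm_nonneg _) hnear 2
    rw [← real_inner_self_eq_norm_sq, Complex.inner_eq_inner_mul_inner_add hw e e, ← hb] at h1
    linarith
  rw [Complex.inner_eq_inner_mul_inner_add hw y e, ← hb, ← hc] at hye
  have hsβ : 0 < s * β := by positivity
  have h1 : s * (d * β / 2) < -(c * inner ℝ w e) := by
    nlinarith [mul_le_mul_of_nonneg_left hbe hd0.le]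
  have h2 : (s * (d * β / 2)) ^ 2 < (c * inner ℝ w e) ^ 2 := by
    rw [← neg_sq (c * inner ℝ w e)]
    exact pow_lt_pow_left₀ h1 (by positivity) two_ne_zero
  have h3 : (s * β) ^ 2 ≤ inner ℝ b e ^ 2 := by
    rw [← neg_sq (inner ℝ b e)]
    exact pow_le_pow_left₀ hsβ.le (by linarith) 2
  have h4 : inner ℝ w e ^ 2 ≤ s ^ 2 * ((β + η) ^ 2 - β ^ 2) := by
    have : s ^ 2 * ((β + η) ^ 2 - β ^ 2) = (s * (β + η)) ^ 2 - (s * β) ^ 2 := by ring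
    linarith
  have h5 := calc (c * inner ℝ w e) ^ 2 = c ^ 2 * inner ℝ w e ^ 2 := mul_pow _ _ _
    _ ≤ c ^ 2 * (s ^ 2 * ((β + η) ^ 2 - β ^ 2)) := mul_le_mul_of_nonneg_left h4 (sq_nonneg c)
    _ = s ^ 2 * (c ^ 2 * ((β + η) ^ 2 - β ^ 2)) := by ring
    _ < s ^ 2 * (d * β / 2) ^ 2 := mul_lt_mul_of_pos_left hη1 (pow_pos hs0 2)
    _ = (s * (d * β / 2)) ^ 2 := (mul_pow _ _ _).symm
  exact lt_asymm h2 h5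

theorem exists_orthogonal_eq_zero (hF : IsTwoAgentMechanism F) :
    ∃ w : ℂ, ‖w‖ = 1 ∧ F w (Complex.I * w) = 0 := by
  obtain ⟨w, hw, hwre, hwim, hext, happ⟩ := hF.exists_extreme_direction
  refine ⟨w, hw, ?_⟩
  rcases hwim.eq_or_lt with him | him
  · have hsq := Complex.norm_sq_eq_re_im w
    have hw1 : w = 1 := by
      apply Complex.ext
      · rw [hw, ← him] at hsq
        rw [Complex.one_re]
        nlinarith
      · rw [Complex.one_im, him]
    rw [hw1] at hext ⊢
    exact hF.eq_zero_of_forall_inner_nonpos hext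
  by_contra hne
  set b := Complex.I * w with hb
  obtain ⟨r, hr⟩ : ∃ r, F w b = r := ⟨_, rfl⟩
  rw [hr] at hne
  have hwr : 0 < inner ℝ w r := by
    have := hF.inner_sub_nonneg_of_right_fixed (hF.right_fixed hr)
    rw [inner_sub_left, real_inner_self_eq_norm_sq] at this
    have : 0 < ‖r‖ ^ 2 := by positivity
    linarith
  have hopen : IsOpen {u : ℂ | 0 < inner ℝ w u ∧ 0 < inner ℝ u r} := by
    have h1 : IsOpen {u : ℂ | 0 < inner ℝ w u} := isOpen_lt continuous_const (by fun_prop)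
    have h2 : IsOpen {u : ℂ | 0 < inner ℝ u r} := isOpen_lt continuous_const (by fun_prop)
    exact h1.inter h2
  have hwmem : w ∈ {u : ℂ | 0 < inner ℝ w u ∧ 0 < inner ℝ u r} := by
    refine ⟨?_, hwr⟩
    rw [real_inner_self_eq_norm_sq, hw]
    norm_num
  obtain ⟨δ, hδ, hball⟩ := Metric.isOpen_iff.1 hopen w hwmem
  obtain ⟨p, hp0, hp, hpw⟩ := happ δ hδ
  have hpn : 0 < ‖p‖ := norm_pos_iff.2 hp0
  have hpmem : p ∈ {u : ℂ | 0 < inner ℝ w u ∧ 0 < inner ℝ u r} := by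
    obtain ⟨h1, h2⟩ := hball (by rwa [Metric.mem_ball, dist_eq_norm] :
      (‖p‖⁻¹ : ℝ) • p ∈ Metric.ball w δ)
    rw [inner_smul_right] at h1
    rw [inner_smul_left] at h2
    exact ⟨pos_of_mul_pos_right h1 (by positivity), pos_of_mul_pos_right h2 (by simp)⟩
  have htend : Filter.Tendsto (fun t : ℝ => p + t • (1 - p)) (nhdsWithin 0 (Set.Ioi 0))
      (nhds (p + (0 : ℝ) • (1 - p))) :=
    tendsto_nhdsWithin_of_tendsto_nhds (Continuous.tendsto (by fun_prop) 0)
  rw [zero_smul, add_zero] at htend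
  obtain ⟨t, ⟨⟨h1, h2⟩, ht0⟩, ht1⟩ := (((htend.eventually (hopen.mem_nhds hpmem)).and
    self_mem_nhdsWithin).and (nhdsWithin_le_nhds (gt_mem_nhds one_pos))).exists
  have ht0 : 0 < t := ht0
  have hy := hF.right_fixed_toward hp ht0.le ht1.le
  have hyb : inner ℝ b (p + t • (1 - p)) < 0 := by
    have e1 : inner ℝ b (1 : ℂ) = -w.im := by
      rw [Complex.real_inner_eq, hb]
      simp
    rw [inner_add_right, inner_smul_right, inner_sub_right, e1]
    have := hext p hp
    nlinarith [mul_pos ht0 him]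
  have hzero := hF.eq_zero_of_near_extreme hw hext happ hyb h1
  have := hF.flip.inner_nonpos_of_eq_zero hzero (hF.left_fixed hr)
  linarith

end IsTwoAgentMechanism

end Plane

section Coalition

variable {ι E : Type*} [NormedAddCommGroup E] {g : (ι → E) → E}

/-- A strategyproof mechanism is strategyproof against coalitions located at a common point. -/
theorem norm_sub_le_of_forall_mem_eq [DecidableEq ι]
    (hg : ∀ P i p, ‖P i - g P‖ ≤ ‖P i - g (Function.update P i p)‖) {p : E} (S : Finset ι)
    {P P' : ι → E} (hS : ∀ i ∈ S, P i = p) (hSc : ∀ i ∉ S, P i = P' i) :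
    ‖p - g P‖ ≤ ‖p - g P'‖ := by
  induction S using Finset.induction_on generalizing P with
  | empty => rw [funext fun i => hSc i (Finset.notMem_empty i)]
  | insert j S hj ih =>
    have h1 := hg P j (P' j)
    rw [hS j (Finset.mem_insert_self j S)] at h1
    refine h1.trans (ih (fun i hi => ?_) fun i hi => ?_)
    · rw [Function.update_of_ne (ne_of_mem_of_not_mem hi hj)]
      exact hS i (Finset.mem_insert_of_mem hi)
    · rcases eq_or_ne i j with rfl | hij
      · rw [Function.update_self]
      · rw [Function.update_of_ne hij]
        exact hSc i (by simp [hij, hi])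

theorem apply_eq_of_forall_mem_eq [DecidableEq ι]
    (hg : ∀ P i p, ‖P i - g P‖ ≤ ‖P i - g (Function.update P i p)‖) (S : Finset ι)
    {P P' : ι → E} (hS : ∀ i ∈ S, P i = g P') (hSc : ∀ i ∉ S, P i = P' i) : g P = g P' := by
  have h := norm_sub_le_of_forall_mem_eq hg S hS hSc
  rw [sub_self, norm_zero] at h
  exact (sub_eq_zero.1 (norm_le_zero_iff.1 h)).symm

theorem isTwoAgentMechanism_coalition [Fintype ι] [DecidableEq ι]
    (hg : ∀ P i p, ‖P i - g P‖ ≤ ‖P i - g (Function.update P i p)‖)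
    (hconst : ∀ x, g (fun _ => x) = x)
    (hne : ∀ P i j, P i ≠ 0 → P j = -P i → (∀ k, P k = P i ∨ P k = -P i) → g P ≠ P i)
    (S : Finset ι) {i j : ι} (hi : i ∈ S) (hj : j ∉ S) :
    IsTwoAgentMechanism fun a b => g fun k => if k ∈ S then a else b where
  left_le a a' b := by
    refine norm_sub_le_of_forall_mem_eq hg S (fun k hk => if_pos hk) fun k hk => ?_
    rw [if_neg hk, if_neg hk]
  right_le a b b' := by
    refine norm_sub_le_of_forall_mem_eq hg Sᶜ (fun k hk => if_neg (Finset.mem_compl.1 hk))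
      fun k hk => ?_
    rw [Finset.mem_compl, not_not] at hk
    rw [if_pos hk, if_pos hk]
  unanimous x := by simp [hconst]
  left_ne y hy := by
    have h := hne (fun k => if k ∈ S then y else -y) i j
    simp only [if_pos hi, if_neg hj] at h
    exact h hy trivial fun k => by split_ifs <;> simp
  right_ne y hy := by
    have h := hne (fun k => if k ∈ S then -y else y) j i
    simp only [if_pos hi, if_neg hj] at h
    exact h hy trivial fun k => by split_ifs <;> simp

end Coalition

theorem exists_three_point_profile_eq_zero {ι : Type*} [Fintype ι] [DecidableEq ι]
    {g : (ι → ℂ) → ℂ}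
    (hg : ∀ P i p, ‖P i - g P‖ ≤ ‖P i - g (Function.update P i p)‖)
    (hconst : ∀ x, g (fun _ => x) = x)
    (hne : ∀ P i j, P i ≠ 0 → P j = -P i → (∀ k, P k = P i ∨ P k = -P i) → g P ≠ P i)
    {i₀ i₁ i₂ : ι} (h01 : i₀ ≠ i₁) (h02 : i₀ ≠ i₂) (h12 : i₁ ≠ i₂) {t : ℝ} (ht : 0 ≤ t) :
    ∃ w : ℂ, ‖w‖ = 1 ∧
      g (fun k => if k = i₀ then w else if k = i₁ then Complex.I * w
        else t • (w + Complex.I * w)) = 0 := by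
  have H₁ := isTwoAgentMechanism_coalition hg hconst hne {i₀} (i := i₀) (j := i₁)
    (by simp) (by simp [h01.symm])
  have H₂ := isTwoAgentMechanism_coalition hg hconst hne {i₁}ᶜ (i := i₀) (j := i₁)
    (by simp [h01]) (by simp)
  have H₃ := isTwoAgentMechanism_coalition hg hconst hne {i₀, i₁} (i := i₀) (j := i₂)
    (by simp) (by simp [h02.symm, h12.symm])
  obtain ⟨w, hw, hF₁⟩ := H₁.exists_orthogonal_eq_zero
  refine ⟨w, hw, ?_⟩
  set b := Complex.I * w
  have hF₂ : g (fun k => if k ∈ ({i₁}ᶜ : Finset ι) then w else b) = 0 := by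
    obtain ⟨y, hy⟩ : ∃ y, g (fun k => if k ∈ ({i₁}ᶜ : Finset ι) then w else b) = y := ⟨_, rfl⟩
    have hwy := H₂.right_fixed hy
    have hy₁ : g (fun k => if k ∈ ({i₀} : Finset ι) then w else y) = y := by
      conv_rhs => rw [← hwy]
      refine apply_eq_of_forall_mem_eq hg {i₀, i₁}ᶜ (fun k hk => ?_) fun k hk => ?_
      · simp only [Finset.mem_compl, Finset.mem_insert, Finset.mem_singleton, not_or] at hk
        simp only [Finset.mem_singleton, if_neg hk.1]
        exact hwy.symm
      · simp only [Finset.mem_compl, Finset.mem_insert, Finset.mem_singleton, not_not] at hk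
        rcases hk with rfl | rfl
        · simp [h01]
        · simp [h01.symm]
    rw [hy]
    exact eq_zero_of_inner_sub_nonneg (H₁.inner_nonpos_of_eq_zero hF₁ hy₁)
      (H₂.inner_sub_nonneg_of_left_fixed (H₂.left_fixed hy))
  set c := t • (w + b) with hc
  obtain ⟨x, hx⟩ : ∃ x, g (fun k => if k = i₀ then w else if k = i₁ then b else c) = x :=
    ⟨_, rfl⟩
  have hx₂ : g (fun k => if k ∈ ({i₁}ᶜ : Finset ι) then x else b) = x := by
    conv_rhs => rw [← hx]
    refine apply_eq_of_forall_mem_eq hg {i₁}ᶜ (fun k hk => ?_) fun k hk => ?_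
    · rw [if_pos hk, hx]
    · rw [if_neg hk]
      simp only [Finset.mem_compl, Finset.mem_singleton, not_not] at hk
      simp [hk, h01.symm]
  have hx₁ : g (fun k => if k ∈ ({i₀} : Finset ι) then w else x) = x := by
    conv_rhs => rw [← hx]
    refine apply_eq_of_forall_mem_eq hg {i₀}ᶜ (fun k hk => ?_) fun k hk => ?_
    · rw [if_neg (Finset.mem_compl.1 hk), hx]
    · simp only [Finset.mem_compl, Finset.mem_singleton, not_not] at hk
      simp [hk]
  have hx₃ : g (fun k => if k ∈ ({i₀, i₁} : Finset ι) then x else c) = x := by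
    conv_rhs => rw [← hx]
    refine apply_eq_of_forall_mem_eq hg {i₀, i₁} (fun k hk => ?_) fun k hk => ?_
    · rw [if_pos hk, hx]
    · rw [if_neg hk]
      simp only [Finset.mem_insert, Finset.mem_singleton, not_or] at hk
      simp [hk]
  have h1 := H₁.inner_nonpos_of_eq_zero hF₁ hx₁
  have h2 := H₂.flip.inner_nonpos_of_eq_zero hF₂ hx₂
  have h3 := H₃.inner_sub_nonneg_of_left_fixed hx₃
  rw [hx]
  refine eq_zero_of_inner_sub_nonneg (b := c) ?_ h3
  rw [hc, inner_smul_left, inner_add_left]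
  exact mul_nonpos_of_nonneg_of_nonpos ht (by linarith)

section Plane

theorem eudist_re_im (z w : ℂ) : eudist (z.re, z.im) (w.re, w.im) = ‖z - w‖ := by
  rw [eudist, ← Complex.sub_re, ← Complex.sub_im, ← Complex.norm_sq_eq_re_im,
    Real.sqrt_sq (norm_nonneg _)]

theorem eudist_eq_norm (a b : ℝ × ℝ) : eudist a b = ‖(⟨a.1, a.2⟩ : ℂ) - ⟨b.1, b.2⟩‖ :=
  eudist_re_im ⟨a.1, a.2⟩ ⟨b.1, b.2⟩

theorem eudist_nonneg (a b : ℝ × ℝ) : 0 ≤ eudist a b := Real.sqrt_nonneg _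

variable {n : ℕ}

theorem eudist_le_Ce (y : ℝ × ℝ) (P : Fin n → ℝ × ℝ) (i : Fin n) : eudist y (P i) ≤ Ce y P :=
  le_ciSup (f := fun i => eudist y (P i)) (Set.finite_range _).bddAbove i

theorem Ce_nonneg (y : ℝ × ℝ) (P : Fin n → ℝ × ℝ) : 0 ≤ Ce y P :=
  Real.iSup_nonneg fun _ => eudist_nonneg _ _

theorem Ce_le {y : ℝ × ℝ} {P : Fin n → ℝ × ℝ} {r : ℝ} (hr : 0 ≤ r)
    (h : ∀ i, eudist y (P i) ≤ r) : Ce y P ≤ r :=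
  Real.iSup_le h hr

theorem iInf_Ce_nonneg (P : Fin n → ℝ × ℝ) : 0 ≤ ⨅ y, Ce y P :=
  Real.iInf_nonneg fun y => Ce_nonneg y P

theorem iInf_Ce_le (y : ℝ × ℝ) (P : Fin n → ℝ × ℝ) : ⨅ y, Ce y P ≤ Ce y P :=
  ciInf_le ⟨0, by rintro _ ⟨z, rfl⟩; exact Ce_nonneg z P⟩ y

/-- A bounded multiplicative guarantee forces a mechanism to be unanimous. -/
theorem eq_of_Ce_le_mul_iInf {x y : ℝ × ℝ} {r : ℝ} (i : Fin n)
    (h : Ce y (fun _ : Fin n => x) ≤ r * ⨅ z, Ce z (fun _ : Fin n => x)) : y = x := by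
  have h0 : ⨅ z, Ce z (fun _ : Fin n => x) = 0 := by
    refine le_antisymm ((iInf_Ce_le x _).trans (Ce_le le_rfl fun _ => ?_)) (iInf_Ce_nonneg _)
    simp [eudist]
  rw [h0, mul_zero] at h
  have h1 := (eudist_le_Ce y (fun _ => x) i).trans h
  rw [eudist_eq_norm, norm_le_zero_iff, sub_eq_zero, Complex.mk.injEq] at h1
  exact Prod.ext h1.1 h1.2

end Plane

/-- no strategyproof and anonymous mechanism with predictions is
simultaneously (2 - ε)-consistent and (1 + √2 - ε)-robust for the egalitarian
objective. -/
theorem no_good_consistent_robust_egalitarian (n : ℕ) (hn : 3 ≤ n) (ε : ℝ) (hε : 0 < ε) :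
    ¬ ∃ f : (Fin n → ℝ × ℝ) → (ℝ × ℝ) → ℝ × ℝ,
      -- strategyproof
      (∀ (P : Fin n → ℝ × ℝ) (oh : ℝ × ℝ) (i : Fin n) (p' : ℝ × ℝ),
        eudist (P i) (f P oh) ≤ eudist (P i) (f (Function.update P i p') oh)) ∧
      -- anonymous
      (∀ (P : Fin n → ℝ × ℝ) (oh : ℝ × ℝ) (σ : Equiv.Perm (Fin n)),
        f (P ∘ σ) oh = f P oh) ∧
      -- (2 - ε)-consistent
      (∀ (P : Fin n → ℝ × ℝ) (o : ℝ × ℝ), (∀ y : ℝ × ℝ, Ce o P ≤ Ce y P) →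
        Ce (f P o) P ≤ (2 - ε) * Ce o P) ∧
      -- (1 + √2 - ε)-robust
      (∀ (P : Fin n → ℝ × ℝ) (oh : ℝ × ℝ),
        Ce (f P oh) P ≤ (1 + Real.sqrt 2 - ε) * ⨅ y : ℝ × ℝ, Ce y P) := by
  rintro ⟨f, hsp, -, hcons, hrob⟩
  let q : ℂ → ℝ × ℝ := fun z => (z.re, z.im)
  have hq : ∀ z w, eudist (q z) (q w) = ‖z - w‖ := eudist_re_im
  have hqs : ∀ p, q ⟨p.1, p.2⟩ = p := fun _ => rfl
  let g : (Fin n → ℂ) → ℂ := fun P => ⟨(f (q ∘ P) (q 0)).1, (f (q ∘ P) (q 0)).2⟩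
  have hfg : ∀ P, f (q ∘ P) (q 0) = q (g P) := fun P => rfl
  have hg : ∀ P i p, ‖P i - g P‖ ≤ ‖P i - g (Function.update P i p)‖ := by
    intro P i p
    have h := hsp (q ∘ P) (q 0) i (q p)
    rwa [← Function.comp_update, hfg, hfg, Function.comp_apply, hq, hq] at h
  have hconst : ∀ x, g (fun _ => x) = x := by
    intro x
    have h := eq_of_Ce_le_mul_iInf (n := n) (x := q x) ⟨0, by lia⟩
      (hrob (q ∘ fun _ => x) (q 0))
    exact congrArg (fun p : ℝ × ℝ => (⟨p.1, p.2⟩ : ℂ)) h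
  have hne : ∀ P i j, P i ≠ 0 → P j = -P i → (∀ k, P k = P i ∨ P k = -P i) → g P ≠ P i := by
    intro P i j hi hj hP heq
    have hpos : 0 < ‖P i‖ := norm_pos_iff.2 hi
    have h0 : Ce (q 0) (q ∘ P) ≤ ‖P i‖ := by
      refine Ce_le (norm_nonneg _) fun k => ?_
      rw [Function.comp_apply, hq, zero_sub, norm_neg]
      rcases hP k with h | h <;> simp [h]
    have hmin : ∀ y, Ce (q 0) (q ∘ P) ≤ Ce y (q ∘ P) := by
      intro y
      have h1 := eudist_le_Ce y (q ∘ P) i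
      have h2 := eudist_le_Ce y (q ∘ P) j
      rw [← hqs y, Function.comp_apply, hq] at h1 h2
      rw [hj] at h2
      rw [hqs] at h1 h2
      have h3 := norm_sub_le ((⟨y.1, y.2⟩ : ℂ) - -P i) ((⟨y.1, y.2⟩ : ℂ) - P i)
      have e : ((⟨y.1, y.2⟩ : ℂ) - -P i) - ((⟨y.1, y.2⟩ : ℂ) - P i) = (2 : ℝ) • P i := by
        module
      rw [e, norm_smul, Real.norm_ofNat] at h3
      linarith
    have h1 := hcons (q ∘ P) (q 0) hmin
    have h2 := eudist_le_Ce (q (g P)) (q ∘ P) j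
    rw [Function.comp_apply, hq, heq, hj, sub_neg_eq_add, ← two_smul ℝ, norm_smul,
      Real.norm_ofNat] at h2
    rw [hfg, heq] at h1
    nlinarith [Ce_nonneg (q 0) (q ∘ P), mul_nonneg hε.le (Ce_nonneg (q 0) (q ∘ P))]
  have h2 : Real.sqrt 2 ^ 2 = 2 := Real.sq_sqrt (by norm_num)
  have h2pos : 0 < Real.sqrt 2 := by positivity
  obtain ⟨w, hw, hP⟩ := exists_three_point_profile_eq_zero hg hconst hne
    (i₀ := ⟨0, by lia⟩) (i₁ := ⟨1, by lia⟩) (i₂ := ⟨2, by lia⟩) (by simp) (by simp) (by simp)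
    (t := 1 + Real.sqrt 2 / 2) (by positivity)
  set P : Fin n → ℂ := fun k => if k = ⟨0, by lia⟩ then w else if k = ⟨1, by lia⟩ then
    Complex.I * w else (1 + Real.sqrt 2 / 2) • (w + Complex.I * w) with hPdef
  have hnorm : ‖w + Complex.I * w‖ = Real.sqrt 2 := by
    rw [← sq_eq_sq₀ (norm_nonneg _) h2pos.le, h2, Complex.norm_sq_eq_re_im]
    have h := Complex.norm_sq_eq_re_im w
    rw [hw] at h
    simp only [Complex.add_re, Complex.add_im, Complex.mul_re, Complex.mul_im, Complex.I_re,
      Complex.I_im]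
    linear_combination -2 * h
  have hupper : Ce (q (w + Complex.I * w)) (q ∘ P) ≤ 1 := by
    refine Ce_le zero_le_one fun k => ?_
    rw [Function.comp_apply, hq, hPdef]
    dsimp only
    split_ifs
    · simp [hw]
    · simp [hw]
    · have e : (w + Complex.I * w) - (1 + Real.sqrt 2 / 2) • (w + Complex.I * w) =
          (-(Real.sqrt 2 / 2)) • (w + Complex.I * w) := by module
      rw [e, norm_smul, hnorm, norm_neg, Real.norm_of_nonneg (by positivity)]
      nlinarith
  have hlower := eudist_le_Ce (q 0) (q ∘ P) ⟨2, by lia⟩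
  have hP2 : P ⟨2, by lia⟩ = (1 + Real.sqrt 2 / 2) • (w + Complex.I * w) := by simp [hPdef]
  rw [Function.comp_apply, hq, hP2, zero_sub, norm_neg, norm_smul, hnorm,
    Real.norm_of_nonneg (by positivity)] at hlower
  have h := hrob (q ∘ P) (q 0)
  rw [hfg, hP] at h
  have hopt := (iInf_Ce_le _ _).trans hupper
  have hopt0 := iInf_Ce_nonneg (q ∘ P)
  nlinarith [mul_nonneg hε.le hopt0]
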